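/- The set A = {Ξ(x, y) : x, y ∈ K} of 2×2 complex matrices, where Ξ(x, y) = [[x, y], [ζ₈·σ(y), σ(x)]], is closed under matrix addition and matrix multiplication, and every nonzero element of A is invertible with its inverse again in A. In other words, the matrix representation of the cyclic algebra (K/F, σ, ζ₈) is a division algebra; in particular, for (x₁, y₁) ≠ (0,0) and (x₂, y₂) arbitrary, the product Ξ(x₂, y₂)·Ξ(x₁, y₁)⁻¹ again lies in A. -/

import Mathlib

open Complex Matrix

/-- The eighth root of unity `ζ₈ = e^{iπ/4}`. -/
noncomputable def ζ₈ : ℂ := Complex.exp (Real.pi * Complex.I / 4)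

/-- The golden ratio `θ = (1+√5)/2` as a complex number. -/
noncomputable def θ : ℂ := (((1 + Real.sqrt 5) / 2 : ℝ) : ℂ)

/-- Its conjugate `θ̄ = (1−√5)/2` as a complex number. -/
noncomputable def θbar : ℂ := (((1 - Real.sqrt 5) / 2 : ℝ) : ℂ)

/-- The subfield `ℚ(i) = {p + q·i : p, q ∈ ℚ}` of `ℂ`, as a set. -/
def Qi : Set ℂ := {z | ∃ p q : ℚ, z = (p : ℂ) + (q : ℂ) * Complex.I}

/-- The element `x = x₀ + x₁ζ₈ + x₂θ + x₃ζ₈θ` of `K = ℚ(ζ₈, √5)` with coordinates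
`x₀, x₁, x₂, x₃ ∈ ℚ(i)` over the basis `(1, ζ₈, θ, ζ₈θ)`. -/
noncomputable def emb (a : Fin 4 → ℂ) : ℂ := a 0 + a 1 * ζ₈ + a 2 * θ + a 3 * ζ₈ * θ

/-- The image `σ(x) = x₀ + x₁ζ₈ + x₂θ̄ + x₃ζ₈θ̄` of `x` under the automorphism `σ` of `K`
fixing `F = ℚ(ζ₈)` with `σ(√5) = −√5`. -/
noncomputable def embσ (a : Fin 4 → ℂ) : ℂ := a 0 + a 1 * ζ₈ + a 2 * θbar + a 3 * ζ₈ * θbar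

/-- The Golden-code codeword matrix `Ξ(x, y) = [[x, y], [ζ₈·σ(y), σ(x)]]`, where `x` and `y`
are given by their coordinates `a`, `b` over the `ℚ(i)`-basis `(1, ζ₈, θ, ζ₈θ)` of `K`. -/
noncomputable def Xi (a b : Fin 4 → ℂ) : Matrix (Fin 2) (Fin 2) ℂ :=
  !![emb a, emb b; ζ₈ * embσ b, embσ a]

/-- The matrix representation `A = {Ξ(x, y) : x, y ∈ K}` of the cyclic algebra
`(K/F, σ, ζ₈)`, as a set of `2 × 2` complex matrices. -/
noncomputable def algA : Set (Matrix (Fin 2) (Fin 2) ℂ) :=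
  {M | ∃ a b : Fin 4 → ℂ, (∀ i, a i ∈ Qi) ∧ (∀ i, b i ∈ Qi) ∧ M = Xi a b}

/-- If `w ^ 2` lies in the subfield `k`, the elements `p + q * w` with `p, q ∈ k` form a
subfield. -/
def quadraticSubfield (k : Subfield ℂ) (w : ℂ) (hw : w ^ 2 ∈ k) : Subfield ℂ where
  carrier := {z | ∃ p ∈ k, ∃ q ∈ k, z = p + q * w}
  zero_mem' := ⟨0, k.zero_mem, 0, k.zero_mem, by simp⟩
  one_mem' := ⟨1, k.one_mem, 0, k.zero_mem, by simp⟩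
  add_mem' := by
    rintro _ _ ⟨p, hp, q, hq, rfl⟩ ⟨r, hr, s, hs, rfl⟩
    exact ⟨p + r, k.add_mem hp hr, q + s, k.add_mem hq hs, by ring⟩
  neg_mem' := by
    rintro _ ⟨p, hp, q, hq, rfl⟩
    exact ⟨-p, k.neg_mem hp, -q, k.neg_mem hq, by ring⟩
  mul_mem' := by
    rintro _ _ ⟨p, hp, q, hq, rfl⟩ ⟨r, hr, s, hs, rfl⟩
    exact ⟨p * r + q * s * w ^ 2,
      k.add_mem (k.mul_mem hp hr) (k.mul_mem (k.mul_mem hq hs) hw),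
      p * s + q * r, k.add_mem (k.mul_mem hp hs) (k.mul_mem hq hr), by ring⟩
  inv_mem' := by
    rintro _ ⟨p, hp, q, hq, rfl⟩
    by_cases h : p - q * w = 0
    · refine ⟨(2 * p)⁻¹, k.inv_mem (k.mul_mem (ofNat_mem k 2) hp), 0, k.zero_mem, ?_⟩
      rw [← sub_eq_zero.mp h]
      ring
    · have hd : p ^ 2 - q ^ 2 * w ^ 2 ∈ k :=
        k.sub_mem (pow_mem hp 2) (k.mul_mem (pow_mem hq 2) hw)
      refine ⟨p * (p ^ 2 - q ^ 2 * w ^ 2)⁻¹, k.mul_mem hp (k.inv_mem hd),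
        -q * (p ^ 2 - q ^ 2 * w ^ 2)⁻¹, k.mul_mem (k.neg_mem hq) (k.inv_mem hd), ?_⟩
      have hf : p ^ 2 - q ^ 2 * w ^ 2 = (p + q * w) * (p - q * w) := by ring
      rw [hf, mul_inv]
      calc (p + q * w)⁻¹ = (p + q * w)⁻¹ * ((p - q * w) * (p - q * w)⁻¹) := by
            rw [mul_inv_cancel₀ h, mul_one]
        _ = _ := by ring

/-- `ℚ(i)` as a subfield of `ℂ`. -/
noncomputable def gaussianRat : Subfield ℂ := quadraticSubfield (algebraMap ℚ ℂ).fieldRange I (by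
  rw [I_sq]
  exact neg_mem (one_mem _))

lemma mem_gaussianRat {z : ℂ} : z ∈ gaussianRat ↔ z ∈ Qi := by
  constructor
  · rintro ⟨_, ⟨p, rfl⟩, _, ⟨q, rfl⟩, rfl⟩
    exact ⟨p, q, rfl⟩
  · rintro ⟨p, q, rfl⟩
    exact ⟨p, ⟨p, rfl⟩, q, ⟨q, rfl⟩, rfl⟩

lemma ζ₈_sq : ζ₈ ^ 2 = I := by
  rw [ζ₈, ← Complex.exp_nat_mul]
  convert Complex.exp_pi_div_two_mul_I using 2
  push_cast
  ring

/-- `F = ℚ(ζ₈)` as a subfield of `ℂ`. -/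
noncomputable def cyclotomicEight : Subfield ℂ :=
  quadraticSubfield gaussianRat ζ₈ (by
    rw [ζ₈_sq, mem_gaussianRat]
    exact ⟨0, 1, by simp⟩)

lemma mem_cyclotomicEight {z : ℂ} :
    z ∈ cyclotomicEight ↔ ∃ p ∈ Qi, ∃ q ∈ Qi, z = p + q * ζ₈ := by
  simp only [← mem_gaussianRat]
  rfl

lemma ζ₈_mem : ζ₈ ∈ cyclotomicEight :=
  mem_cyclotomicEight.mpr ⟨0, ⟨0, 0, by simp⟩, 1, ⟨1, 0, by simp⟩, by simp⟩

lemma θ_add_θbar : θ + θbar = 1 := by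
  rw [θ, θbar, ← ofReal_add, ← ofReal_one]
  congr 1
  ring

lemma θ_mul_θbar : θ * θbar = -1 := by
  have h : Real.sqrt 5 * Real.sqrt 5 = 5 := Real.mul_self_sqrt (by norm_num)
  rw [θ, θbar, ← ofReal_mul, ← ofReal_one, ← ofReal_neg]
  congr 1
  linarith

/-- The relation `x ∈ K` and `x' = σ(x)`. -/
def IsGaloisConj (x x' : ℂ) : Prop :=
  ∃ f ∈ cyclotomicEight, ∃ g ∈ cyclotomicEight, x = f + g * θ ∧ x' = f + g * θbar

lemma isGaloisConj_iff {x x' : ℂ} :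
    IsGaloisConj x x' ↔ ∃ a : Fin 4 → ℂ, (∀ i, a i ∈ Qi) ∧ x = emb a ∧ x' = embσ a := by
  constructor
  · rintro ⟨f, hf, g, hg, rfl, rfl⟩
    obtain ⟨p, hp, q, hq, rfl⟩ := mem_cyclotomicEight.mp hf
    obtain ⟨r, hr, s, hs, rfl⟩ := mem_cyclotomicEight.mp hg
    refine ⟨![p, q, r, s], ?_, ?_, ?_⟩
    · intro i
      fin_cases i <;> assumption
    · simp only [emb, Matrix.cons_val]
      ring
    · simp only [embσ, Matrix.cons_val]
      ring
  · rintro ⟨a, ha, rfl, rfl⟩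
    refine ⟨a 0 + a 1 * ζ₈, mem_cyclotomicEight.mpr ⟨_, ha 0, _, ha 1, rfl⟩,
      a 2 + a 3 * ζ₈, mem_cyclotomicEight.mpr ⟨_, ha 2, _, ha 3, rfl⟩, ?_, ?_⟩
    · rw [emb]
      ring
    · rw [embσ]
      ring

lemma mem_algA {M : Matrix (Fin 2) (Fin 2) ℂ} :
    M ∈ algA ↔ ∃ x x' y y', IsGaloisConj x x' ∧ IsGaloisConj y y' ∧ M = !![x, y; ζ₈ * y', x'] := by
  simp only [isGaloisConj_iff]
  constructor
  · rintro ⟨a, b, ha, hb, rfl⟩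
    exact ⟨_, _, _, _, ⟨a, ha, rfl, rfl⟩, ⟨b, hb, rfl, rfl⟩, rfl⟩
  · rintro ⟨_, _, _, _, ⟨a, ha, rfl, rfl⟩, ⟨b, hb, rfl, rfl⟩, rfl⟩
    exact ⟨a, b, ha, hb, rfl⟩

namespace IsGaloisConj

variable {x x' y y' : ℂ}

lemma of_mem (hx : x ∈ cyclotomicEight) : IsGaloisConj x x :=
  ⟨x, hx, 0, zero_mem _, by simp, by simp⟩

lemma add (hx : IsGaloisConj x x') (hy : IsGaloisConj y y') : IsGaloisConj (x + y) (x' + y') := by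
  obtain ⟨f, hf, g, hg, rfl, rfl⟩ := hx
  obtain ⟨h, hh, k, hk, rfl, rfl⟩ := hy
  exact ⟨f + h, add_mem hf hh, g + k, add_mem hg hk, by ring, by ring⟩

lemma mul (hx : IsGaloisConj x x') (hy : IsGaloisConj y y') : IsGaloisConj (x * y) (x' * y') := by
  obtain ⟨f, hf, g, hg, rfl, rfl⟩ := hx
  obtain ⟨h, hh, k, hk, rfl, rfl⟩ := hy
  refine ⟨f * h + g * k, add_mem (mul_mem hf hh) (mul_mem hg hk),
    f * k + g * h + g * k,
    add_mem (add_mem (mul_mem hf hk) (mul_mem hg hh)) (mul_mem hg hk), ?_, ?_⟩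
  · linear_combination (g * k * θ) * θ_add_θbar - g * k * θ_mul_θbar
  · linear_combination (g * k * θbar) * θ_add_θbar - g * k * θ_mul_θbar

lemma neg (hx : IsGaloisConj x x') : IsGaloisConj (-x) (-x') := by
  obtain ⟨f, hf, g, hg, rfl, rfl⟩ := hx
  exact ⟨-f, neg_mem hf, -g, neg_mem hg, by ring, by ring⟩

lemma symm (hx : IsGaloisConj x x') : IsGaloisConj x' x := by
  obtain ⟨f, hf, g, hg, rfl, rfl⟩ := hx
  refine ⟨f + g, add_mem hf hg, -g, neg_mem hg, ?_, ?_⟩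
  · linear_combination g * θ_add_θbar
  · linear_combination g * θ_add_θbar

lemma mul_self_mem (hx : IsGaloisConj x x') : x * x' ∈ cyclotomicEight := by
  obtain ⟨f, hf, g, hg, rfl, rfl⟩ := hx
  have h : (f + g * θ) * (f + g * θbar) = f * f + f * g - g * g := by
    linear_combination f * g * θ_add_θbar + g * g * θ_mul_θbar
  rw [h]
  exact sub_mem (add_mem (mul_mem hf hf) (mul_mem hf hg)) (mul_mem hg hg)

end IsGaloisConj

lemma add_mem_algA {M N : Matrix (Fin 2) (Fin 2) ℂ} (hM : M ∈ algA) (hN : N ∈ algA) :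
    M + N ∈ algA := by
  obtain ⟨x, x', y, y', hx, hy, rfl⟩ := mem_algA.mp hM
  obtain ⟨u, u', v, v', hu, hv, rfl⟩ := mem_algA.mp hN
  refine mem_algA.mpr ⟨_, _, _, _, hx.add hu, hy.add hv, ?_⟩
  ext i j
  fin_cases i <;> fin_cases j <;> simp [mul_add]

lemma mul_mem_algA {M N : Matrix (Fin 2) (Fin 2) ℂ} (hM : M ∈ algA) (hN : N ∈ algA) :
    M * N ∈ algA := by
  obtain ⟨x, x', y, y', hx, hy, rfl⟩ := mem_algA.mp hM
  obtain ⟨u, u', v, v', hu, hv, rfl⟩ := mem_algA.mp hN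
  refine mem_algA.mpr ⟨_, _, _, _,
    (hx.mul hu).add ((IsGaloisConj.of_mem ζ₈_mem).mul (hy.mul hv.symm)),
    (hx.mul hv).add (hy.mul hu.symm), ?_⟩
  ext i j
  fin_cases i <;> fin_cases j <;> simp [Matrix.mul_apply, Fin.sum_univ_two] <;> ring

/-- Infinite descent at a non-unit `π`: a property of families that is inherited by an exact
quotient by `π` holds for the zero family only. -/
lemma eq_zero_of_descent {R ι : Type*} [CommRing R] [IsDomain R] [WfDvdMonoid R] {π : R}
    (hπ : ¬IsUnit π) {P : (ι → R) → Prop} (hP : ∀ x, P x → ∃ y, P y ∧ x = π • y)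
    {x : ι → R} (hx : P x) : x = 0 := by
  have h : ∀ n : ℕ, ∀ x, P x → ∀ i, π ^ n ∣ x i := by
    intro n
    induction n with
    | zero => simp
    | succ n ih =>
      intro x hx i
      obtain ⟨y, hy, rfl⟩ := hP x hx
      rw [pow_succ']
      exact mul_dvd_mul_left π (ih y hy i)
  funext i
  by_contra hi
  obtain ⟨n, hn⟩ := FiniteMultiplicity.of_not_isUnit hπ hi
  exact hn (h _ x hx i)

/-- Reduction of the Gaussian integers modulo `2 + i`. -/
def gaussianMod : GaussianInt →+* ZMod 5 := Zsqrtd.lift ⟨3, by decide⟩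

lemma dvd_of_gaussianMod_eq_zero {z : GaussianInt} (hz : gaussianMod z = 0) :
    (⟨2, 1⟩ : GaussianInt) ∣ z := by
  have h : ((z.re + z.im * 3 : ℤ) : ZMod 5) = 0 := by
    simpa [gaussianMod] using hz
  obtain ⟨k, hk⟩ := (ZMod.intCast_zmod_eq_zero_iff_dvd _ 5).mp h
  refine ⟨⟨2 * k - z.im, z.im - k⟩, ?_⟩
  push_cast at hk
  ext <;> simp <;> linarith

lemma exists_eq_smul_of_gaussianMod_eq_zero {ι : Type*} {x : ι → GaussianInt}
    (hx : ∀ i, gaussianMod (x i) = 0) : ∃ y : ι → GaussianInt, x = (⟨2, 1⟩ : GaussianInt) • y := by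
  choose y hy using fun i ↦ dvd_of_gaussianMod_eq_zero (hx i)
  exact ⟨y, funext hy⟩

lemma not_isUnit_two_add_I : ¬IsUnit (⟨2, 1⟩ : GaussianInt) := by
  rw [← Zsqrtd.norm_eq_one_iff]
  decide

lemma two_add_I_ne_zero : (⟨2, 1⟩ : GaussianInt) ≠ 0 := by
  decide

lemma gaussianMod_two_add_I : gaussianMod ⟨2, 1⟩ = 0 := by
  simp [gaussianMod]
  decide

lemma gaussianMod_sqrtd : gaussianMod ⟨0, 1⟩ = 3 := by
  simp [gaussianMod]

lemma eq_zero_of_sq_eq_I_mul_sq {x : Fin 2 → GaussianInt}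
    (hx : x 0 ^ 2 = ⟨0, 1⟩ * x 1 ^ 2) : x = 0 := by
  refine eq_zero_of_descent not_isUnit_two_add_I
    (P := fun x ↦ x 0 ^ 2 = (⟨0, 1⟩ : GaussianInt) * x 1 ^ 2) (fun x hx ↦ ?_) hx
  have key : ∀ a b : ZMod 5, a ^ 2 = 3 * b ^ 2 → a = 0 ∧ b = 0 := by decide
  have h := congrArg gaussianMod hx
  simp only [map_mul, map_pow, gaussianMod_sqrtd] at h
  obtain ⟨h0, h1⟩ := key _ _ h
  obtain ⟨y, rfl⟩ := exists_eq_smul_of_gaussianMod_eq_zero (x := x)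
    (by intro i; fin_cases i <;> assumption)
  refine ⟨y, mul_left_cancel₀ (pow_ne_zero 2 two_add_I_ne_zero) ?_, rfl⟩
  simp only [Pi.smul_apply, smul_eq_mul] at hx
  linear_combination hx

lemma toComplex_I : GaussianInt.toComplex ⟨0, 1⟩ = I := by
  simp [GaussianInt.toComplex_def]

lemma eq_zero_of_add_mul_ζ₈_eq_zero {u v : GaussianInt}
    (h : GaussianInt.toComplex u + GaussianInt.toComplex v * ζ₈ = 0) : u = 0 ∧ v = 0 := by
  have h2 : u ^ 2 = ⟨0, 1⟩ * v ^ 2 := by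
    apply GaussianInt.toComplex_injective
    rw [map_mul, map_pow, map_pow, toComplex_I]
    linear_combination (GaussianInt.toComplex u - GaussianInt.toComplex v * ζ₈) * h +
      GaussianInt.toComplex v ^ 2 * ζ₈_sq
  have h3 := eq_zero_of_sq_eq_I_mul_sq (x := ![u, v]) (by simpa using h2)
  exact ⟨by simpa using congrFun h3 0, by simpa using congrFun h3 1⟩

/-- The two `ℚ(i)`-coordinates of `a² - 5b² = ζ₈(c² - 5d²)`, where `a = x₀ + x₁ζ₈`,
`b = x₂ + x₃ζ₈`, `c = x₄ + x₅ζ₈` and `d = x₆ + x₇ζ₈`. -/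
def NormEquation (x : Fin 8 → GaussianInt) : Prop :=
  x 0 ^ 2 + ⟨0, 1⟩ * x 1 ^ 2 - 5 * (x 2 ^ 2 + ⟨0, 1⟩ * x 3 ^ 2) =
      ⟨0, 1⟩ * (2 * x 4 * x 5 - 5 * (2 * x 6 * x 7)) ∧
    2 * x 0 * x 1 - 5 * (2 * x 2 * x 3) =
      x 4 ^ 2 + ⟨0, 1⟩ * x 5 ^ 2 - 5 * (x 6 ^ 2 + ⟨0, 1⟩ * x 7 ^ 2)

/-- The class of `ζ₈` is not a square in the field with 25 elements. -/
lemma eq_zero_of_sq_eq_generator_mul_sq : ∀ a b c d : ZMod 5,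
    a ^ 2 + 3 * b ^ 2 = 3 * (2 * c * d) → 2 * a * b = c ^ 2 + 3 * d ^ 2 →
      a = 0 ∧ b = 0 ∧ c = 0 ∧ d = 0 := by
  decide +kernel

lemma five_eq : (5 : GaussianInt) = ⟨2, 1⟩ * ⟨2, -1⟩ := by
  decide

lemma NormEquation.eq_zero {x : Fin 8 → GaussianInt} (hx : NormEquation x) : x = 0 := by
  refine eq_zero_of_descent not_isUnit_two_add_I (fun x hx ↦ ?_) hx
  obtain ⟨h1, h2⟩ := hx
  have h5 : (5 : ZMod 5) = 0 := by decide
  have g1 := congrArg gaussianMod h1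
  have g2 := congrArg gaussianMod h2
  simp only [map_mul, map_pow, map_add, map_sub, map_ofNat, gaussianMod_sqrtd, h5, zero_mul,
    sub_zero] at g1 g2
  obtain ⟨m0, m1, m4, m5⟩ := eq_zero_of_sq_eq_generator_mul_sq _ _ _ _ g1 g2
  obtain ⟨y0, e0⟩ := dvd_of_gaussianMod_eq_zero m0
  obtain ⟨y1, e1⟩ := dvd_of_gaussianMod_eq_zero m1
  obtain ⟨y4, e4⟩ := dvd_of_gaussianMod_eq_zero m4
  obtain ⟨y5, e5⟩ := dvd_of_gaussianMod_eq_zero m5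
  have k1 : (⟨2, -1⟩ : GaussianInt) * (x 2 ^ 2 + ⟨0, 1⟩ * x 3 ^ 2 - ⟨0, 1⟩ * (2 * x 6 * x 7)) =
      ⟨2, 1⟩ * (y0 ^ 2 + ⟨0, 1⟩ * y1 ^ 2 - ⟨0, 1⟩ * (2 * y4 * y5)) := by
    apply mul_left_cancel₀ two_add_I_ne_zero
    rw [e0, e1, e4, e5, five_eq] at h1
    linear_combination -h1
  have k2 : (⟨2, -1⟩ : GaussianInt) * (2 * x 2 * x 3 - (x 6 ^ 2 + ⟨0, 1⟩ * x 7 ^ 2)) =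
      ⟨2, 1⟩ * (2 * y0 * y1 - (y4 ^ 2 + ⟨0, 1⟩ * y5 ^ 2)) := by
    apply mul_left_cancel₀ two_add_I_ne_zero
    rw [e0, e1, e4, e5, five_eq] at h2
    linear_combination -h2
  have hc : gaussianMod ⟨2, -1⟩ ≠ 0 := by
    simp [gaussianMod]
    decide
  have : Fact (Nat.Prime 5) := ⟨Nat.prime_five⟩
  have g3 := congrArg gaussianMod k1
  have g4 := congrArg gaussianMod k2
  rw [map_mul, map_mul, gaussianMod_two_add_I, zero_mul] at g3 g4
  replace g3 := (mul_eq_zero.mp g3).resolve_left hc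
  replace g4 := (mul_eq_zero.mp g4).resolve_left hc
  simp only [map_mul, map_pow, map_add, map_sub, map_ofNat, gaussianMod_sqrtd,
    sub_eq_zero] at g3 g4
  obtain ⟨m2, m3, m6, m7⟩ := eq_zero_of_sq_eq_generator_mul_sq _ _ _ _ g3 g4
  obtain ⟨y, rfl⟩ := exists_eq_smul_of_gaussianMod_eq_zero (x := x)
    (by intro i; fin_cases i <;> assumption)
  refine ⟨y, ⟨mul_left_cancel₀ (pow_ne_zero 2 two_add_I_ne_zero) ?_,
    mul_left_cancel₀ (pow_ne_zero 2 two_add_I_ne_zero) ?_⟩, rfl⟩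
  · simp only [Pi.smul_apply, smul_eq_mul] at h1
    linear_combination h1
  · simp only [Pi.smul_apply, smul_eq_mul] at h2
    linear_combination h2

lemma exists_common_denominator {ι : Type*} [Fintype ι] {a : ι → ℂ} (ha : ∀ i, a i ∈ Qi) :
    ∃ N : ℕ, N ≠ 0 ∧ ∃ g : ι → GaussianInt, ∀ i, GaussianInt.toComplex (g i) = N * a i := by
  have single : ∀ i, ∃ N : ℕ, N ≠ 0 ∧ ∃ g : GaussianInt, GaussianInt.toComplex g = N * a i := by
    intro i
    obtain ⟨p, q, h⟩ := ha i
    refine ⟨p.den * q.den, mul_ne_zero p.den_ne_zero q.den_ne_zero,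
      ⟨p.num * q.den, q.num * p.den⟩, ?_⟩
    have hp : (p.den : ℂ) * p = p.num := by exact_mod_cast Rat.den_mul_eq_num p
    have hq : (q.den : ℂ) * q = q.num := by exact_mod_cast Rat.den_mul_eq_num q
    rw [h, GaussianInt.toComplex_def]
    push_cast
    linear_combination -(q.den : ℂ) * hp - (p.den : ℂ) * I * hq
  choose N hN g hg using single
  refine ⟨∏ i, N i, Finset.prod_ne_zero_iff.mpr fun i _ ↦ hN i, ?_⟩
  have hdvd : ∀ i, ∃ m, ∏ j, N j = N i * m := fun i ↦ Finset.dvd_prod_of_mem N (Finset.mem_univ i)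
  choose m hm using hdvd
  refine ⟨fun i ↦ m i * g i, fun i ↦ ?_⟩
  rw [hm, map_mul, map_natCast, hg]
  push_cast
  ring

/-- The quaternary form `a² - 5b² - ζ₈(c² - 5d²)` is anisotropic over `ℚ(ζ₈)`. -/
lemma eq_zero_of_sq_sub_five_mul_sq {a b c d : ℂ} (ha : a ∈ cyclotomicEight)
    (hb : b ∈ cyclotomicEight) (hc : c ∈ cyclotomicEight) (hd : d ∈ cyclotomicEight)
    (h : a ^ 2 - 5 * b ^ 2 = ζ₈ * (c ^ 2 - 5 * d ^ 2)) : a = 0 ∧ b = 0 ∧ c = 0 ∧ d = 0 := by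
  obtain ⟨a0, ha0, a1, ha1, rfl⟩ := mem_cyclotomicEight.mp ha
  obtain ⟨b0, hb0, b1, hb1, rfl⟩ := mem_cyclotomicEight.mp hb
  obtain ⟨c0, hc0, c1, hc1, rfl⟩ := mem_cyclotomicEight.mp hc
  obtain ⟨d0, hd0, d1, hd1, rfl⟩ := mem_cyclotomicEight.mp hd
  obtain ⟨N, hN, g, hg⟩ := exists_common_denominator (a := ![a0, a1, b0, b1, c0, c1, d0, d1])
    (by intro i; fin_cases i <;> assumption)
  have g0 : GaussianInt.toComplex (g 0) = N * a0 := hg 0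
  have g1 : GaussianInt.toComplex (g 1) = N * a1 := hg 1
  have g2 : GaussianInt.toComplex (g 2) = N * b0 := hg 2
  have g3 : GaussianInt.toComplex (g 3) = N * b1 := hg 3
  have g4 : GaussianInt.toComplex (g 4) = N * c0 := hg 4
  have g5 : GaussianInt.toComplex (g 5) = N * c1 := hg 5
  have g6 : GaussianInt.toComplex (g 6) = N * d0 := hg 6
  have g7 : GaussianInt.toComplex (g 7) = N * d1 := hg 7
  have hg0 : g = 0 := by
    apply NormEquation.eq_zero
    rw [NormEquation, ← sub_eq_zero, ← sub_eq_zero (b := _ - _)]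
    apply eq_zero_of_add_mul_ζ₈_eq_zero
    simp only [map_sub, map_add, map_mul, map_pow, map_ofNat, toComplex_I, g0, g1, g2, g3, g4,
      g5, g6, g7, ← ζ₈_sq]
    linear_combination (N : ℂ) ^ 2 * h
  have hN' : (N : ℂ) ≠ 0 := Nat.cast_ne_zero.mpr hN
  simp only [hg0, Pi.zero_apply, map_zero, zero_eq_mul, hN', false_or] at g0 g1 g2 g3 g4 g5 g6 g7
  simp [g0, g1, g2, g3, g4, g5, g6, g7]

lemma IsGaloisConj.eq_zero_of_mul_eq {x x' y y' : ℂ} (hx : IsGaloisConj x x') (hy : IsGaloisConj y y')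
    (h : x * x' = ζ₈ * (y * y')) : (x = 0 ∧ x' = 0) ∧ y = 0 ∧ y' = 0 := by
  obtain ⟨f, hf, g, hg, rfl, rfl⟩ := hx
  obtain ⟨k, hk, l, hl, rfl, rfl⟩ := hy
  have h2 : (2 : ℂ) ∈ cyclotomicEight := ofNat_mem _ 2
  obtain ⟨e1, rfl, e2, rfl⟩ := eq_zero_of_sq_sub_five_mul_sq
    (add_mem (mul_mem h2 hf) hg) hg (add_mem (mul_mem h2 hk) hl) hl (by
      linear_combination 4 * h - 4 * (f * g * θ_add_θbar + g * g * θ_mul_θbar) +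
        4 * ζ₈ * (k * l * θ_add_θbar + l * l * θ_mul_θbar))
  have hf0 : f = 0 := by simpa using e1
  have hk0 : k = 0 := by simpa using e2
  simp [hf0, hk0]

lemma isUnit_and_inv_mem_algA {M : Matrix (Fin 2) (Fin 2) ℂ} (hM : M ∈ algA) (h0 : M ≠ 0) :
    IsUnit M ∧ M⁻¹ ∈ algA := by
  obtain ⟨x, x', y, y', hx, hy, rfl⟩ := mem_algA.mp hM
  have hdet : !![x, y; ζ₈ * y', x'].det = x * x' - ζ₈ * (y * y') := by
    rw [Matrix.det_fin_two_of]
    ring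
  have hne : x * x' - ζ₈ * (y * y') ≠ 0 := by
    intro h
    obtain ⟨⟨rfl, rfl⟩, rfl, rfl⟩ := hx.eq_zero_of_mul_eq hy (sub_eq_zero.mp h)
    apply h0
    ext i j
    fin_cases i <;> fin_cases j <;> simp
  refine ⟨(Matrix.isUnit_iff_isUnit_det _).mpr (by rw [hdet]; exact hne.isUnit), ?_⟩
  have hmem : (x * x' - ζ₈ * (y * y'))⁻¹ ∈ cyclotomicEight :=
    inv_mem (sub_mem hx.mul_self_mem (mul_mem ζ₈_mem hy.mul_self_mem))
  refine mem_algA.mpr ⟨_, _, _, _, (IsGaloisConj.of_mem hmem).mul hx.symm,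
    (IsGaloisConj.of_mem hmem).mul hy.neg, ?_⟩
  rw [Matrix.inv_def, hdet, Ring.inverse_eq_inv', Matrix.adjugate_fin_two_of]
  ext i j
  fin_cases i <;> fin_cases j <;> simp
  ring

/-- The set `A = {Ξ(x, y) : x, y ∈ K}` is closed under matrix addition and multiplication,
and every nonzero element of `A` is invertible with inverse again in `A`; in particular, for
`M, N ∈ A` with `M ≠ 0`, the quotient `N·M⁻¹` again lies in `A` (division-algebra property). -/
theorem golden_algebra_is_division_algebra :
    (∀ M ∈ algA, ∀ N ∈ algA, M + N ∈ algA) ∧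
    (∀ M ∈ algA, ∀ N ∈ algA, M * N ∈ algA) ∧
    (∀ M ∈ algA, M ≠ 0 → IsUnit M ∧ M⁻¹ ∈ algA) ∧
    (∀ M ∈ algA, ∀ N ∈ algA, M ≠ 0 → N * M⁻¹ ∈ algA) := by
  exact ⟨fun _ hM _ hN ↦ add_mem_algA hM hN, fun _ hM _ hN ↦ mul_mem_algA hM hN,
    fun _ hM h0 ↦ isUnit_and_inv_mem_algA hM h0,
    fun _ hM _ hN h0 ↦ mul_mem_algA hN (isUnit_and_inv_mem_algA hM h0).2⟩
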